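/- Let ν, a, s ∈ ℝ with ν ≠ 0 and s ≠ 0, and let r ∈ ℤ. Suppose that every solution x of the class-D equation with parameters (ν, a, s) satisfies x(2π) = x(0) + 2πr. Then: a = 0 if and only if r = 0; if r > 0 then 0 < a ≤ r; and if r < 0 then r ≤ a < 0. -/

import Mathlib

open Real

/-- A solution of the class-D equation `ẋ = ν sin x + a + s sin t`. -/
def IsClassDSolution (ν a s : ℝ) (x : ℝ → ℝ) : Prop :=
  ∀ t : ℝ, HasDerivAt x (ν * Real.sin (x t) + a + s * Real.sin t) t

open Set Filter Topology MeasureTheory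
open scoped NNReal

/-- A bounded, uniformly Lipschitz vector field continuous in time has global integral curves. -/
theorem exists_forall_hasDerivAt_of_lipschitz_of_bounded {v : ℝ → ℝ → ℝ} {K L : ℝ≥0}
    (hlip : ∀ t, LipschitzWith K (v t)) (hcont : ∀ y, Continuous fun t => v t y)
    (hbound : ∀ t y, ‖v t y‖ ≤ L) (x₀ : ℝ) :
    ∃ x : ℝ → ℝ, x 0 = x₀ ∧ ∀ t, HasDerivAt x (v t (x t)) t := by
  have hlocal : ∀ n : ℕ, ∃ α : ℝ → ℝ, α 0 = x₀ ∧
      ∀ t ∈ Ioo (-((n : ℝ) + 1)) (n + 1), HasDerivAt α (v t (α t)) t := by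
    intro n
    have hmem : (0 : ℝ) ∈ Icc (-((n : ℝ) + 1)) (n + 1) := by
      constructor <;> linarith [n.cast_nonneg (α := ℝ)]
    have hPL : IsPicardLindelof v (⟨0, hmem⟩ : Icc (-((n : ℝ) + 1)) (n + 1)) x₀
        (L * (n + 1)) 0 L K :=
      { lipschitzOnWith := fun t _ => (hlip t).lipschitzOnWith
        continuousOn := fun y _ => (hcont y).continuousOn
        norm_le := fun t _ y _ => hbound t y
        mul_max_le := by simp }
    obtain ⟨α, hα₀, hα⟩ := hPL.exists_eq_forall_mem_Icc_hasDerivWithinAt₀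
    exact ⟨α, hα₀, fun t ht =>
      (hα t (Ioo_subset_Icc_self ht)).hasDerivAt (Icc_mem_nhds ht.1 ht.2)⟩
  choose α hα₀ hα using hlocal
  have hagree : ∀ m n : ℕ, m ≤ n → EqOn (α m) (α n) (Ioo (-((m : ℝ) + 1)) (m + 1)) := by
    intro m n hmn
    have hmn' : (m : ℝ) ≤ n := by exact_mod_cast hmn
    have hm : (0 : ℝ) ≤ m := m.cast_nonneg
    refine ODE_solution_unique_of_mem_Ioo (v := v) (s := fun _ => univ) (K := K) (t₀ := 0)
      (fun t _ => (hlip t).lipschitzOnWith) ⟨by linarith, by linarith⟩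
      (fun t ht => ⟨hα m t ht, trivial⟩) (fun t ht => ⟨hα n t ?_, trivial⟩) ?_
    · exact ⟨by linarith [ht.1], by linarith [ht.2]⟩
    · rw [hα₀, hα₀]
  have hceil : ∀ t : ℝ, t ∈ Ioo (-((⌈|t|⌉₊ : ℝ) + 1)) (⌈|t|⌉₊ + 1) := by
    intro t
    have h1 := Nat.le_ceil |t|
    have h2 := abs_le.1 (le_refl |t|)
    exact ⟨by linarith [h2.1], by linarith [h2.2]⟩
  have hx : ∀ (N : ℕ) (t : ℝ), t ∈ Ioo (-((N : ℝ) + 1)) (N + 1) → α ⌈|t|⌉₊ t = α N t := by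
    intro N t ht
    rcases le_total ⌈|t|⌉₊ N with h | h
    · exact hagree _ _ h (hceil t)
    · exact (hagree _ _ h ht).symm
  refine ⟨fun t => α ⌈|t|⌉₊ t, by simp [hα₀], fun t => ?_⟩
  have ht := hceil t
  refine (hα _ t ht).congr_of_eventuallyEq ?_
  filter_upwards [Ioo_mem_nhds ht.1 ht.2] with τ hτ using hx _ τ hτ

theorem lipschitzWith_classD (ν a s t : ℝ) :
    LipschitzWith ‖ν‖₊ fun y : ℝ => ν * Real.sin y + a + s * Real.sin t := by
  refine LipschitzWith.of_dist_le_mul fun y z => ?_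
  rw [Real.dist_eq, Real.dist_eq, coe_nnnorm, Real.norm_eq_abs]
  have : ν * Real.sin y + a + s * Real.sin t - (ν * Real.sin z + a + s * Real.sin t)
      = ν * (Real.sin y - Real.sin z) := by ring
  rw [this, abs_mul]
  exact mul_le_mul_of_nonneg_left
    (by simpa [Real.dist_eq] using Real.lipschitzWith_sin.dist_le_mul y z) (abs_nonneg ν)

namespace IsClassDSolution

variable {ν a s : ℝ} {x y : ℝ → ℝ}

theorem exists_eq (ν a s x₀ : ℝ) : ∃ x : ℝ → ℝ, x 0 = x₀ ∧ IsClassDSolution ν a s x := by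
  refine exists_forall_hasDerivAt_of_lipschitz_of_bounded
    (v := fun t y => ν * Real.sin y + a + s * Real.sin t) (L := ‖ν‖₊ + ‖a‖₊ + ‖s‖₊)
    (lipschitzWith_classD ν a s) (fun y => by fun_prop) (fun t y => ?_) x₀
  push_cast
  refine (norm_add₃_le).trans ?_
  rw [norm_mul, norm_mul]
  gcongr
  · exact mul_le_of_le_one_right (norm_nonneg _) (Real.abs_sin_le_one _)
  · exact mul_le_of_le_one_right (norm_nonneg _) (Real.abs_sin_le_one _)

theorem continuous (hx : IsClassDSolution ν a s x) : Continuous x :=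
  continuous_iff_continuousAt.2 fun t => (hx t).continuousAt

theorem eq_of_eq_at (hx : IsClassDSolution ν a s x) (hy : IsClassDSolution ν a s y) {t₀ : ℝ}
    (h : x t₀ = y t₀) : x = y :=
  ODE_solution_unique_univ (v := fun t y => ν * Real.sin y + a + s * Real.sin t)
    (s := fun _ => univ) (fun t => (lipschitzWith_classD ν a s t).lipschitzOnWith)
    (fun t => ⟨hx t, trivial⟩) (fun t => ⟨hy t, trivial⟩) h

/-- The order of two solutions is preserved in time. -/
theorem lt_of_lt_at (hx : IsClassDSolution ν a s x) (hy : IsClassDSolution ν a s y) {t₀ : ℝ}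
    (h : x t₀ < y t₀) (t : ℝ) : x t < y t := by
  by_contra! hle
  obtain ⟨c, hc⟩ := mem_range_of_exists_le_of_exists_ge (hx.continuous.sub hy.continuous)
    (c := 0) ⟨t₀, by simpa using h.le⟩ ⟨t, by simpa using hle⟩
  have := hx.eq_of_eq_at hy (sub_eq_zero.1 hc)
  simp [this] at h

theorem add_int_mul_two_pi (hx : IsClassDSolution ν a s x) (k : ℤ) :
    IsClassDSolution ν a s fun t => x t + k * (2 * π) := by
  intro t
  simpa [Real.sin_add_int_mul_two_pi] using (hx t).add_const ((k : ℝ) * (2 * π))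

theorem comp_add_two_pi (hx : IsClassDSolution ν a s x) :
    IsClassDSolution ν a s fun t => x (t + 2 * π) := by
  intro t
  simpa using (hx (t + 2 * π)).comp_add_const t (2 * π)

theorem neg (hx : IsClassDSolution ν a s x) :
    IsClassDSolution ν (-a) (-s) fun t => -x t := by
  intro t
  refine (hx t).fun_neg.congr_deriv ?_
  rw [Real.sin_neg]
  ring

theorem neg_comp_add_pi (hx : IsClassDSolution ν 0 s x) :
    IsClassDSolution ν 0 s fun t => -x (t + π) := by
  intro t
  refine ((hx (t + π)).comp_add_const t π).fun_neg.congr_deriv ?_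
  rw [Real.sin_neg, Real.sin_add_pi]
  ring

/-- Raising `a` from `0` strictly raises the solution with the same initial value. -/
theorem lt_of_pos (ha : 0 < a) (hx : IsClassDSolution ν a s x) (hy : IsClassDSolution ν 0 s y)
    (h : y 0 = x 0) {T : ℝ} (hT : 0 < T) : y T < x T := by
  have hle : ∀ t ∈ Icc 0 T, y t ≤ x t :=
    image_le_of_deriv_right_lt_deriv_boundary hy.continuous.continuousOn
      (fun t _ => (hy t).hasDerivWithinAt) h.le hx fun t _ hyx => by rw [hyx]; linarith
  have hderiv : ∀ t, HasDerivAt (fun t => (x t - y t) * Real.exp (|ν| * t))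
      ((ν * (Real.sin (x t) - Real.sin (y t)) + a + |ν| * (x t - y t)) * Real.exp (|ν| * t)) t := by
    intro t
    have hexp : HasDerivAt (fun t => Real.exp (|ν| * t)) (Real.exp (|ν| * t) * |ν|) t := by
      simpa using ((hasDerivAt_id t).const_mul |ν|).exp
    refine (((hx t).fun_sub (hy t)).fun_mul hexp).congr_deriv ?_
    ring
  have hmono : StrictMonoOn (fun t => (x t - y t) * Real.exp (|ν| * t)) (Icc 0 T) := by
    refine strictMonoOn_of_deriv_pos (convex_Icc 0 T)
      (fun t _ => (hderiv t).continuousAt.continuousWithinAt) fun t ht => ?_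
    rw [interior_Icc] at ht
    rw [(hderiv t).deriv]
    have hxy := hle t (Ioo_subset_Icc_self ht)
    have hsin : |Real.sin (x t) - Real.sin (y t)| ≤ x t - y t := by
      have := Real.lipschitzWith_sin.dist_le_mul (x t) (y t)
      rwa [NNReal.coe_one, one_mul, Real.dist_eq, Real.dist_eq,
        abs_of_nonneg (a := x t - y t) (by linarith)] at this
    have hprod : -(|ν| * (x t - y t)) ≤ ν * (Real.sin (x t) - Real.sin (y t)) := by
      refine (neg_le_neg ?_).trans (neg_abs_le _)
      rw [abs_mul]
      gcongr
    have : 0 < Real.exp (|ν| * t) := Real.exp_pos _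
    refine mul_pos ?_ this
    linarith
  have := hmono (left_mem_Icc.2 hT.le) (right_mem_Icc.2 hT.le) hT
  simp only [h, sub_self, zero_mul] at this
  exact sub_pos.1 (pos_of_mul_pos_left this (Real.exp_pos _).le)

end IsClassDSolution

section Sign

variable {ν a s : ℝ} {r : ℤ}

theorem rotation_eq_zero_of_abscissa_eq_zero
    (hconstr : ∀ x : ℝ → ℝ, IsClassDSolution ν 0 s x → x (2 * π) = x 0 + 2 * π * (r : ℝ)) :
    r = 0 := by
  obtain ⟨x, -, hx⟩ := IsClassDSolution.exists_eq ν 0 s 0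
  have h1 := hconstr x hx
  have h2 := hconstr _ hx.neg_comp_add_pi
  have h3 := congrFun (hx.comp_add_two_pi.eq_of_eq_at (hx.add_int_mul_two_pi r) (t₀ := 0)
    (by simp only [zero_add]; linarith)) π
  simp only [zero_add] at h2 h3
  rw [add_comm π (2 * π)] at h3
  have : π * (r : ℝ) = 0 := by linarith
  simpa [Real.pi_ne_zero] using this

theorem rotation_pos_of_abscissa_pos (ha : 0 < a)
    (hconstr : ∀ x : ℝ → ℝ, IsClassDSolution ν a s x → x (2 * π) = x 0 + 2 * π * (r : ℝ)) :
    0 < r := by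
  by_contra! hr
  have hr' : (r : ℝ) ≤ 0 := by exact_mod_cast hr
  have hdecr : ∀ y, IsClassDSolution ν 0 s y → y (2 * π) < y 0 := by
    intro y hy
    obtain ⟨x, hx0, hx⟩ := IsClassDSolution.exists_eq ν a s (y 0)
    have h1 := IsClassDSolution.lt_of_pos ha hx hy hx0.symm Real.two_pi_pos
    have h2 := hconstr x hx
    have h3 := mul_nonpos_of_nonneg_of_nonpos Real.two_pi_pos.le hr'
    linarith
  obtain ⟨y, -, hy⟩ := IsClassDSolution.exists_eq ν 0 s 0
  have h1 := hdecr _ hy.neg_comp_add_pi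
  have h2 := hy.comp_add_two_pi.lt_of_lt_at hy (t₀ := 0) (by simpa using hdecr y hy) π
  simp only [zero_add] at h1
  rw [add_comm π (2 * π)] at h2
  linarith

end Sign

open Polynomial in
/-- The logarithmic derivative of a polynomial without zeros on the unit circle integrates to
`2πi` times a natural number. -/
theorem Polynomial.exists_circleIntegral_logDeriv_eq (P : ℂ[X])
    (hP : ∀ z ∈ Metric.sphere (0 : ℂ) 1, P.eval z ≠ 0) :
    ∃ k : ℕ, (∮ z in C(0, 1), P.derivative.eval z / P.eval z) = 2 * π * Complex.I * k := by
  have key : ∀ m : Multiset ℂ, (∀ w ∈ m, w ∉ Metric.sphere (0 : ℂ) 1) →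
      CircleIntegrable (fun z => (m.map fun w => 1 / (z - w)).sum) 0 1 ∧
      ∃ k : ℕ, (∮ z in C(0, 1), (m.map fun w => 1 / (z - w)).sum) = 2 * π * Complex.I * k := by
    intro m
    induction m using Multiset.induction with
    | empty => exact fun _ => ⟨by simp, 0, by simp [circleIntegral]⟩
    | cons w m ih =>
      intro hm
      obtain ⟨hcoef, k, hk⟩ := ih fun w hw => hm w (Multiset.mem_cons_of_mem hw)
      have hw : w ∉ Metric.sphere (0 : ℂ) 1 := hm w (Multiset.mem_cons_self w m)
      have hwint : CircleIntegrable (fun z => 1 / (z - w)) 0 1 := by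
        simp only [one_div, circleIntegrable_sub_inv_iff]
        right
        simpa using hw
      simp only [Multiset.map_cons, Multiset.sum_cons]
      refine ⟨hwint.add hcoef, ?_⟩
      rw [circleIntegral.integral_add hwint hcoef, hk]
      rcases lt_or_gt_of_ne (fun h : dist w 0 = 1 => hw h) with h | h
      · refine ⟨k + 1, ?_⟩
        simp only [one_div]
        rw [circleIntegral.integral_sub_inv_of_mem_ball (Metric.mem_ball.2 h)]
        push_cast
        ring
      · refine ⟨k, ?_⟩
        have hne : ∀ z ∈ Metric.closedBall (0 : ℂ) 1, z - w ≠ 0 := by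
          intro z hz hzw
          rw [sub_eq_zero.1 hzw] at hz
          exact absurd (Metric.mem_closedBall.1 hz) (not_le.2 h)
        rw [Complex.circleIntegral_eq_zero_of_differentiable_on_off_countable zero_le_one
          Set.countable_empty, zero_add]
        · exact continuousOn_const.div (by fun_prop) hne
        · intro z hz
          exact (differentiableAt_const _).div (by fun_prop)
            (hne z (Metric.ball_subset_closedBall hz.1))
  obtain ⟨-, k, hk⟩ := key P.roots fun w hw hw1 => hP w hw1 (Polynomial.isRoot_of_mem_roots hw)
  refine ⟨k, hk ▸ circleIntegral.integral_congr zero_le_one fun z hz => ?_⟩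
  exact (IsAlgClosed.splits P).eval_derivative_div_eval_of_ne_zero (hP z hz)

/-- A nowhere vanishing loop whose Fourier series has only nonnegative frequencies has nonnegative
winding number around the origin. -/
theorem im_integral_logDeriv_nonneg {c : ℕ → ℂ} (hc : Summable fun n : ℕ => (n : ℝ) * ‖c n‖)
    {g g' : ℝ → ℂ} (hg : Continuous g) (hne : ∀ t ∈ Icc 0 (2 * π), g t ≠ 0)
    (hsum : ∀ t ∈ Icc 0 (2 * π), HasSum (fun n : ℕ => c n * Complex.exp (n * t * Complex.I)) (g t))
    (hsum' : ∀ t ∈ Icc 0 (2 * π),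
      HasSum (fun n : ℕ => Complex.I * n * c n * Complex.exp (n * t * Complex.I)) (g' t)) :
    0 ≤ (∫ t in (0 : ℝ)..2 * π, g' t / g t).im := by
  have hcn : Summable fun n => ‖c n‖ := by
    refine (summable_nat_add_iff 1).1 (((summable_nat_add_iff 1).2 hc).of_nonneg_of_le
      (fun _ => norm_nonneg _) fun n => ?_)
    have : (1 : ℝ) ≤ ((n + 1 : ℕ) : ℝ) := by simp
    exact le_mul_of_one_le_left (norm_nonneg _) this
  have hexp : ∀ (n : ℕ) (t : ℝ), ‖Complex.exp (n * t * Complex.I)‖ = 1 := by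
    intro n t
    simpa using Complex.norm_exp_ofReal_mul_I (n * t)
  set P : ℕ → Polynomial ℂ := fun N => ∑ n ∈ Finset.range N, Polynomial.monomial n (c n) with hPdef
  have hpow : ∀ (n : ℕ) (t : ℝ), circleMap 0 1 t ^ n = Complex.exp (n * t * Complex.I) := by
    intro n t
    rw [circleMap_zero, Complex.ofReal_one, one_mul, ← Complex.exp_nat_mul, mul_assoc]
  have hPeval : ∀ N (t : ℝ), (P N).eval (circleMap 0 1 t) =
      ∑ n ∈ Finset.range N, c n * Complex.exp (n * t * Complex.I) := by
    intro N t
    simp [hPdef, Polynomial.eval_finsetSum, Polynomial.eval_monomial, hpow]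
  have hPeval' : ∀ N (t : ℝ), circleMap 0 1 t * Complex.I * (P N).derivative.eval (circleMap 0 1 t)
      = ∑ n ∈ Finset.range N, Complex.I * n * c n * Complex.exp (n * t * Complex.I) := by
    intro N t
    simp only [hPdef, Polynomial.derivative_sum, Polynomial.eval_finsetSum, Finset.mul_sum,
      Polynomial.derivative_monomial, Polynomial.eval_monomial]
    refine Finset.sum_congr rfl fun n _ => ?_
    rcases n with _ | n
    · simp
    · rw [← hpow, Nat.add_sub_cancel, pow_succ]
      ring
  have huniv : TendstoUniformlyOn (fun N t => (P N).eval (circleMap 0 1 t)) g atTop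
      (Icc 0 (2 * π)) := by
    have := tendstoUniformlyOn_tsum_nat (f := fun (n : ℕ) (t : ℝ) =>
      c n * Complex.exp (n * t * Complex.I)) hcn (s := Icc 0 (2 * π))
      fun n t _ => by rw [norm_mul, hexp, mul_one]
    refine (this.congr (Eventually.of_forall fun N t _ => (hPeval N t).symm)).congr_right ?_
    exact fun t ht => (hsum t ht).tsum_eq
  obtain ⟨t₀, ht₀, hmin⟩ := isCompact_Icc.exists_isMinOn (nonempty_Icc.2 Real.two_pi_pos.le)
    hg.norm.continuousOn
  have hm : 0 < ‖g t₀‖ := norm_pos_iff.2 (hne t₀ ht₀)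
  have hlower : ∀ᶠ N in atTop, ∀ t ∈ Icc 0 (2 * π), ‖g t₀‖ / 2 ≤ ‖(P N).eval (circleMap 0 1 t)‖ := by
    filter_upwards [Metric.tendstoUniformlyOn_iff.1 huniv _ (half_pos hm)] with N hN t ht
    have h1 := hN t ht
    rw [dist_eq_norm] at h1
    have h2 : ‖g t₀‖ ≤ ‖g t‖ := hmin ht
    have h3 := norm_sub_norm_le (g t) ((P N).eval (circleMap 0 1 t))
    linarith
  have hnonneg : ∀ᶠ N in atTop, 0 ≤ (∫ t in (0 : ℝ)..2 * π, circleMap 0 1 t * Complex.I *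
      (P N).derivative.eval (circleMap 0 1 t) / (P N).eval (circleMap 0 1 t)).im := by
    filter_upwards [hlower] with N hN
    obtain ⟨k, hk⟩ := (P N).exists_circleIntegral_logDeriv_eq fun z hz => by
      rw [← abs_one (α := ℝ), ← image_circleMap_Ioc] at hz
      obtain ⟨t, ht, rfl⟩ := hz
      exact norm_pos_iff.1 ((half_pos hm).trans_le (hN t (Ioc_subset_Icc_self ht)))
    simp only [circleIntegral, deriv_circleMap, smul_eq_mul, ← mul_div_assoc] at hk
    rw [hk]
    simp only [Complex.mul_im, Complex.mul_re, Complex.re_ofNat, Complex.im_ofNat,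
      Complex.ofReal_re, Complex.ofReal_im, Complex.I_re, Complex.I_im, Complex.natCast_re,
      Complex.natCast_im]
    ring_nf
    positivity
  refine ge_of_tendsto ?_ hnonneg
  refine (Complex.continuous_im.tendsto _).comp ?_
  refine intervalIntegral.tendsto_integral_filter_of_dominated_convergence
    (fun _ => (∑' n : ℕ, (n : ℝ) * ‖c n‖) / (‖g t₀‖ / 2)) ?_ ?_ (by simp) ?_
  · filter_upwards with N
    exact (by fun_prop : Measurable fun t => circleMap 0 1 t * Complex.I *
      (P N).derivative.eval (circleMap 0 1 t) / (P N).eval (circleMap 0 1 t)).aestronglyMeasurable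
  · filter_upwards [hlower] with N hN
    refine ae_of_all _ fun t ht => ?_
    rw [uIoc_of_le Real.two_pi_pos.le] at ht
    rw [norm_div]
    refine div_le_div₀ (tsum_nonneg fun n => by positivity) ?_ (half_pos hm)
      (hN t (Ioc_subset_Icc_self ht))
    rw [hPeval']
    refine (norm_sum_le _ _).trans ?_
    refine le_trans (Finset.sum_le_sum fun n _ => ?_)
      (hc.sum_le_tsum (Finset.range N) fun n _ => by positivity)
    rw [norm_mul, hexp, mul_one, norm_mul, norm_mul, Complex.norm_I, one_mul, Complex.norm_natCast]
  · refine ae_of_all _ fun t ht => ?_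
    rw [uIoc_of_le Real.two_pi_pos.le] at ht
    have ht' := Ioc_subset_Icc_self ht
    refine Tendsto.div ?_ ?_ (hne t ht')
    · simp only [hPeval']
      exact (hsum' t ht').tendsto_sum_nat
    · simp only [hPeval]
      exact (hsum t ht').tendsto_sum_nat

/-- Pointwise Fourier inversion on `[0, 2π]` for continuous functions with matching end values and
summable Fourier coefficients. -/
theorem hasSum_fourier_integral {g : ℝ → ℂ} (hg : Continuous g) (hper : g 0 = g (2 * π))
    (hsum : Summable fun n : ℤ => ∫ t in (0 : ℝ)..2 * π, g t * Complex.exp (-(n * t * Complex.I)))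
    {t : ℝ} (ht : t ∈ Icc 0 (2 * π)) :
    HasSum (fun n : ℤ => (2 * π : ℂ)⁻¹ * (∫ t in (0 : ℝ)..2 * π,
      g t * Complex.exp (-(n * t * Complex.I))) * Complex.exp (n * t * Complex.I)) (g t) := by
  have : Fact (0 < 2 * π) := ⟨Real.two_pi_pos⟩
  set G : C(AddCircle (2 * π), ℂ) :=
    ⟨AddCircle.liftIco (2 * π) 0 g, AddCircle.liftIco_zero_continuous hper hg.continuousOn⟩ with hG
  have hfour : ∀ (n : ℤ) (τ : ℝ),
      fourier n (τ : AddCircle (2 * π)) = Complex.exp (n * τ * Complex.I) := by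
    intro n τ
    rw [fourier_coe_apply]
    congr 1
    have : (π : ℂ) ≠ 0 := by exact_mod_cast Real.pi_ne_zero
    push_cast
    field_simp
  have hcoeff : ∀ n : ℤ, fourierCoeff G n = (2 * π : ℂ)⁻¹ *
      ∫ t in (0 : ℝ)..2 * π, g t * Complex.exp (-(n * t * Complex.I)) := by
    intro n
    rw [fourierCoeff_eq_intervalIntegral _ _ 0, zero_add, Complex.real_smul]
    congr 1
    · push_cast; simp
    · refine intervalIntegral.integral_congr_Ioo_of_le Real.two_pi_pos.le fun τ hτ => ?_
      have hτ' : G (τ : AddCircle (2 * π)) = g τ :=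
        AddCircle.liftIco_zero_coe_apply (Ioo_subset_Ico_self hτ)
      simp only [hfour, hτ', smul_eq_mul]
      rw [mul_comm]
      push_cast
      simp [neg_mul]
  have hval : G (t : AddCircle (2 * π)) = g t := by
    rcases eq_or_lt_of_le ht.2 with h | h
    · have h0 : ((2 * π : ℝ) : AddCircle (2 * π)) = ((0 : ℝ) : AddCircle (2 * π)) := by
        simp
      have h1 : G ((0 : ℝ) : AddCircle (2 * π)) = g 0 :=
        AddCircle.liftIco_zero_coe_apply ⟨le_rfl, Real.two_pi_pos⟩
      rw [h, h0, h1, hper]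
    · exact AddCircle.liftIco_zero_coe_apply ⟨ht.1, h⟩
  have hS : Summable (fourierCoeff G) := by
    have : fourierCoeff G = fun n : ℤ => (2 * π : ℂ)⁻¹ *
      ∫ t in (0 : ℝ)..2 * π, g t * Complex.exp (-(n * t * Complex.I)) := funext hcoeff
    rw [this]
    exact hsum.mul_left _
  have := has_pointwise_sum_fourier_series_of_summable hS (t : AddCircle (2 * π))
  rw [hval] at this
  simpa only [hcoeff, hfour, smul_eq_mul] using this

/-- Bounded solutions of a three-term recurrence with linearly growing middle coefficient decay
faster than any power. -/
theorem exists_pow_mul_norm_le_of_recurrence {D : ℕ → ℂ} {β : ℕ → ℝ} {s M : ℝ}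
    (hM : ∀ n, ‖D n‖ ≤ M) (hβ : ∀ n : ℕ, (n : ℝ) + 1 ≤ β n)
    (hrec : ∀ n : ℕ, (s / 2 : ℂ) * (D (n + 2) - D n) = Complex.I * β n * D (n + 1)) (j : ℕ) :
    ∃ K, ∀ n : ℕ, ((n : ℝ) + 1) ^ j * ‖D n‖ ≤ K := by
  induction j with
  | zero => exact ⟨M, by simpa using hM⟩
  | succ j ih =>
    obtain ⟨K, hK⟩ := ih
    refine ⟨max ‖D 0‖ (|s| * (K + 2 ^ j * K)), fun n => ?_⟩
    rcases n with _ | n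
    · simp
    refine le_max_of_le_right ?_
    have hn : (0 : ℝ) ≤ n := n.cast_nonneg
    have h1 : ((n : ℝ) + 1) * ‖D (n + 1)‖ ≤ |s| / 2 * (‖D (n + 2)‖ + ‖D n‖) := by
      have h2 := congrArg norm (hrec n)
      simp only [norm_mul, norm_div, Complex.norm_real, Complex.norm_I, one_mul, Complex.norm_ofNat,
        Real.norm_eq_abs] at h2
      calc ((n : ℝ) + 1) * ‖D (n + 1)‖ ≤ |β n| * ‖D (n + 1)‖ := by
            gcongr; exact (hβ n).trans (le_abs_self _)
        _ = |s| / 2 * ‖D (n + 2) - D n‖ := h2.symm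
        _ ≤ _ := by gcongr; exact norm_sub_le _ _
    have h3 := hK (n + 2)
    have h4 := hK n
    push_cast at h3 ⊢
    have h5 : ((n : ℝ) + 1 + 1) ^ j * ‖D (n + 2)‖ ≤ K :=
      le_trans (by gcongr; linarith) h3
    have h6 : ((n : ℝ) + 1 + 1) ^ j * ‖D n‖ ≤ 2 ^ j * K := by
      calc ((n : ℝ) + 1 + 1) ^ j * ‖D n‖ ≤ (2 * ((n : ℝ) + 1)) ^ j * ‖D n‖ := by gcongr; linarith
        _ = 2 ^ j * (((n : ℝ) + 1) ^ j * ‖D n‖) := by rw [mul_pow]; ring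
        _ ≤ _ := by gcongr
    calc ((n : ℝ) + 1 + 1) ^ (j + 1) * ‖D (n + 1)‖
        ≤ ((n : ℝ) + 1 + 1) ^ j * (2 * (((n : ℝ) + 1) * ‖D (n + 1)‖)) := by
          rw [pow_succ, mul_assoc]
          refine mul_le_mul_of_nonneg_left ?_ (by positivity)
          nlinarith [norm_nonneg (D (n + 1))]
      _ ≤ ((n : ℝ) + 1 + 1) ^ j * (2 * (|s| / 2 * (‖D (n + 2)‖ + ‖D n‖))) := by gcongr
      _ = |s| * (((n : ℝ) + 1 + 1) ^ j * ‖D (n + 2)‖ + ((n : ℝ) + 1 + 1) ^ j * ‖D n‖) := by ring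
      _ ≤ _ := by gcongr

/-- The linear system whose projectivization is the class-D equation, in the gauge where it reads
`p'' + i (a + s sin t) p' = (ν² / 4) p` with `q = p'`. -/
structure IsLinearizedSolution (ν a s : ℝ) (p q : ℝ → ℂ) : Prop where
  hasDerivAt_fst : ∀ t, HasDerivAt p (q t) t
  hasDerivAt_snd : ∀ t,
    HasDerivAt q ((ν : ℂ) ^ 2 / 4 * p t - Complex.I * (a + s * Real.sin t) * q t) t

/-- The Fourier integral over one period at a real frequency. -/
noncomputable def fourierIntegralAt (g : ℝ → ℂ) (κ : ℝ) : ℂ :=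
  ∫ t in (0 : ℝ)..2 * π, g t * Complex.exp (-(κ * t * Complex.I))

theorem norm_fourierIntegralAt_le {g : ℝ → ℂ} (hg : Continuous g) :
    ∃ M, ∀ κ, ‖fourierIntegralAt g κ‖ ≤ M := by
  obtain ⟨B, hB⟩ := isCompact_Icc.exists_bound_of_continuousOn
    (hg.continuousOn (s := Icc 0 (2 * π)))
  refine ⟨B * |2 * π - 0|, fun κ => intervalIntegral.norm_integral_le_of_norm_le_const
    fun t ht => ?_⟩
  rw [uIoc_of_le Real.two_pi_pos.le] at ht
  have hexp : ‖Complex.exp (-(κ * t * Complex.I))‖ = 1 := by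
    simpa using Complex.norm_exp_ofReal_mul_I (-(κ * t))
  rw [norm_mul, hexp, mul_one]
  exact hB t (Ioc_subset_Icc_self ht)

theorem fourierIntegralAt_combination {g h : ℝ → ℂ} (hg : Continuous g) (hh : Continuous h)
    (α β : ℂ) (κ : ℝ) :
    fourierIntegralAt (fun t => α * g t + β * h t) κ =
      α * fourierIntegralAt g κ + β * fourierIntegralAt h κ := by
  simp only [fourierIntegralAt, add_mul, mul_assoc]
  rw [intervalIntegral.integral_add, intervalIntegral.integral_const_mul,
    intervalIntegral.integral_const_mul] <;>
  exact Continuous.intervalIntegrable (by fun_prop) _ _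

/-- Integration by parts for a function with multiplier `e^{2πiκ}` over the period. -/
theorem fourierIntegralAt_deriv {g g' : ℝ → ℂ} (hg : ∀ t, HasDerivAt g (g' t) t)
    (hg' : Continuous g') {κ : ℝ}
    (hper : g (2 * π) * Complex.exp (-(κ * (2 * π) * Complex.I)) = g 0) :
    fourierIntegralAt g' κ = Complex.I * κ * fourierIntegralAt g κ := by
  have hgc : Continuous g := continuous_iff_continuousAt.2 fun t => (hg t).continuousAt
  have hexp : ∀ t : ℝ, HasDerivAt (fun t : ℝ => Complex.exp (-(κ * t * Complex.I)))
      (-(κ * Complex.I) * Complex.exp (-(κ * t * Complex.I))) t := by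
    intro t
    have h : HasDerivAt (fun t : ℝ => -((κ : ℂ) * t * Complex.I)) (-(κ * Complex.I)) t := by
      simpa using (((hasDerivAt_id t).ofReal_comp.const_mul (κ : ℂ)).mul_const Complex.I).fun_neg
    exact h.cexp.congr_deriv (by ring)
  have h := intervalIntegral.integral_eq_sub_of_hasDerivAt (a := 0) (b := 2 * π)
    (fun t _ => (hg t).fun_mul (hexp t)) (Continuous.intervalIntegrable (by fun_prop) _ _)
  push_cast at h
  rw [hper] at h
  simp only [mul_zero, zero_mul, neg_zero, Complex.exp_zero, mul_one,
    sub_self] at h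
  rw [intervalIntegral.integral_add (Continuous.intervalIntegrable (by fun_prop) _ _)
    (Continuous.intervalIntegrable (by fun_prop) _ _)] at h
  rw [fourierIntegralAt, fourierIntegralAt, eq_neg_of_add_eq_zero_left h,
    ← intervalIntegral.integral_neg, ← intervalIntegral.integral_const_mul]
  refine intervalIntegral.integral_congr fun t _ => ?_
  ring

namespace IsLinearizedSolution

variable {ν a s : ℝ} {p q p₁ q₁ p₂ q₂ : ℝ → ℂ}

theorem continuous_fst (h : IsLinearizedSolution ν a s p q) : Continuous p :=
  continuous_iff_continuousAt.2 fun t => (h.hasDerivAt_fst t).continuousAt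

theorem continuous_snd (h : IsLinearizedSolution ν a s p q) : Continuous q :=
  continuous_iff_continuousAt.2 fun t => (h.hasDerivAt_snd t).continuousAt

theorem combination (h₁ : IsLinearizedSolution ν a s p₁ q₁) (h₂ : IsLinearizedSolution ν a s p₂ q₂)
    (α β : ℂ) : IsLinearizedSolution ν a s (fun t => α * p₁ t + β * p₂ t)
      (fun t => α * q₁ t + β * q₂ t) where
  hasDerivAt_fst t := ((h₁.hasDerivAt_fst t).const_mul α).add ((h₂.hasDerivAt_fst t).const_mul β)
  hasDerivAt_snd t := (((h₁.hasDerivAt_snd t).const_mul α).fun_add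
    ((h₂.hasDerivAt_snd t).const_mul β)).congr_deriv (by ring)

/-- The three-term recurrence for the Fourier integrals of a solution with multiplier
`e^{2πiκ}`. -/
theorem recurrence (h : IsLinearizedSolution ν a s p q) {κ : ℝ} (hκ : κ ≠ 0)
    (hp : p (2 * π) * Complex.exp (-(κ * (2 * π) * Complex.I)) = p 0)
    (hq : q (2 * π) * Complex.exp (-(κ * (2 * π) * Complex.I)) = q 0) :
    (s / 2 : ℂ) * (fourierIntegralAt q (κ + 1) - fourierIntegralAt q (κ - 1)) =
      Complex.I * ((κ + a + ν ^ 2 / (4 * κ) : ℝ) : ℂ) * fourierIntegralAt q κ := by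
  have hpc := h.continuous_fst
  have hqc := h.continuous_snd
  have h1 := fourierIntegralAt_deriv h.hasDerivAt_fst hqc hp
  have h2 := fourierIntegralAt_deriv h.hasDerivAt_snd (by fun_prop) hq
  have h3 : fourierIntegralAt
      (fun t => (ν : ℂ) ^ 2 / 4 * p t - Complex.I * (a + s * Real.sin t) * q t) κ =
      (ν : ℂ) ^ 2 / 4 * fourierIntegralAt p κ - Complex.I * a * fourierIntegralAt q κ
        - (s / 2 : ℂ) * fourierIntegralAt q (κ - 1) + (s / 2 : ℂ) * fourierIntegralAt q (κ + 1) := by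
    simp only [fourierIntegralAt]
    rw [← intervalIntegral.integral_const_mul, ← intervalIntegral.integral_const_mul,
      ← intervalIntegral.integral_const_mul, ← intervalIntegral.integral_const_mul,
      ← intervalIntegral.integral_sub, ← intervalIntegral.integral_sub,
      ← intervalIntegral.integral_add]
    · refine intervalIntegral.integral_congr fun t _ => ?_
      have e1 : Complex.exp (-(((κ - 1 : ℝ) : ℂ) * t * Complex.I)) =
          Complex.exp (-(κ * t * Complex.I)) * Complex.exp (t * Complex.I) := by
        rw [← Complex.exp_add]; congr 1; push_cast; ring
      have e2 : Complex.exp (-(((κ + 1 : ℝ) : ℂ) * t * Complex.I)) =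
          Complex.exp (-(κ * t * Complex.I)) * Complex.exp (-t * Complex.I) := by
        rw [← Complex.exp_add]; congr 1; push_cast; ring
      simp only [e1, e2, Complex.ofReal_sin, Complex.sin]
      linear_combination ((s : ℂ) / 2 * q t * Complex.exp (-(κ * t * Complex.I)) *
        (Complex.exp (t * Complex.I) - Complex.exp (-t * Complex.I))) * Complex.I_mul_I
    all_goals exact Continuous.intervalIntegrable (by fun_prop) _ _
  rw [h3] at h2
  have hκ' : (κ : ℂ) ≠ 0 := by exact_mod_cast hκ
  push_cast
  have h4 : fourierIntegralAt p κ = -Complex.I * fourierIntegralAt q κ / κ := by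
    rw [h1]
    field_simp
    linear_combination fourierIntegralAt p κ * Complex.I_mul_I
  rw [h4] at h2
  field_simp at h2 ⊢
  linear_combination h2

end IsLinearizedSolution

/-- A nowhere vanishing loop with vanishing negative Fourier coefficients has nonnegative winding
number around the origin. -/
theorem im_integral_logDeriv_nonneg_of_fourierIntegralAt {g g' : ℝ → ℂ}
    (hg : ∀ t, HasDerivAt g (g' t) t) (hg' : Continuous g') (hper : g 0 = g (2 * π))
    (hper' : g' 0 = g' (2 * π)) (hne : ∀ t, g t ≠ 0)
    (hneg : ∀ n : ℤ, n < 0 → fourierIntegralAt g n = 0)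
    (hdecay : ∃ K, ∀ n : ℕ, ((n : ℝ) + 1) ^ 2 * ‖fourierIntegralAt g' n‖ ≤ K) :
    0 ≤ (∫ t in (0 : ℝ)..2 * π, g' t / g t).im := by
  have hgc : Continuous g := continuous_iff_continuousAt.2 fun t => (hg t).continuousAt
  have hderiv : ∀ n : ℤ, fourierIntegralAt g' n = Complex.I * n * fourierIntegralAt g n := by
    intro n
    have := fourierIntegralAt_deriv hg hg' (κ := n) (by
      have : Complex.exp (-(((n : ℝ) : ℂ) * (2 * π) * Complex.I)) = 1 :=
        Complex.exp_eq_one_iff.2 ⟨-n, by push_cast; ring⟩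
      rw [this, mul_one, hper])
    simpa using this
  have hneg' : ∀ n : ℤ, n < 0 → fourierIntegralAt g' n = 0 := fun n hn => by
    rw [hderiv, hneg n hn, mul_zero]
  have hS' : Summable fun n : ℕ => ‖fourierIntegralAt g' n‖ := by
    obtain ⟨K, hK⟩ := hdecay
    refine Summable.of_nonneg_of_le (fun _ => norm_nonneg _) (fun n => ?_)
      (((summable_nat_add_iff 1).2 (Real.summable_one_div_nat_pow.2 one_lt_two)).mul_left K)
    have : (0 : ℝ) < ((n : ℝ) + 1) ^ 2 := by positivity
    push_cast
    rw [mul_one_div, le_div_iff₀ this, mul_comm]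
    exact hK n
  have hnorm : ∀ n : ℕ, ‖fourierIntegralAt g' n‖ = n * ‖fourierIntegralAt g n‖ := by
    intro n
    have := congrArg norm (hderiv n)
    simpa using this
  have hS : Summable fun n : ℕ => ‖fourierIntegralAt g n‖ := by
    refine (summable_nat_add_iff 1).1 (((summable_nat_add_iff 1).2 hS').of_nonneg_of_le
      (fun _ => norm_nonneg _) fun n => ?_)
    rw [hnorm]
    exact le_mul_of_one_le_left (norm_nonneg _) (by simp)
  have hsupp : ∀ {F : ℤ → ℂ}, (∀ n : ℤ, n < 0 → F n = 0) → ∀ n ∉ range ((↑) : ℕ → ℤ), F n = 0 := by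
    intro F hF n hn
    refine hF n (lt_of_not_ge fun h => hn ⟨n.toNat, Int.toNat_of_nonneg h⟩)
  have hhas : ∀ {G : ℝ → ℂ}, Continuous G → G 0 = G (2 * π) →
      (∀ n : ℤ, n < 0 → fourierIntegralAt G n = 0) →
      (Summable fun n : ℕ => ‖fourierIntegralAt G n‖) → ∀ t ∈ Icc 0 (2 * π),
      HasSum (fun n : ℕ => (2 * π : ℂ)⁻¹ * fourierIntegralAt G n * Complex.exp (n * t * Complex.I))
        (G t) := by
    intro G hG hGper hGneg hGsum t ht
    have hcoef : ∀ n : ℤ, (∫ t in (0 : ℝ)..2 * π, G t * Complex.exp (-(n * t * Complex.I))) =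
        fourierIntegralAt G n := fun n => by simp [fourierIntegralAt]
    have hZ : Summable fun n : ℤ => fourierIntegralAt G n := by
      rw [← (Nat.cast_injective (R := ℤ)).summable_iff (hsupp hGneg)]
      simpa [Function.comp_def] using hGsum.of_norm
    have := hasSum_fourier_integral hG hGper (by simpa only [hcoef] using hZ) ht
    simp only [hcoef] at this
    rw [← (Nat.cast_injective (R := ℤ)).hasSum_iff
      (hsupp fun n hn => by rw [hGneg n hn]; simp)] at this
    simpa [Function.comp_def] using this
  refine im_integral_logDeriv_nonneg (c := fun n => (2 * π : ℂ)⁻¹ * fourierIntegralAt g n)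
    ?_ hgc (fun t _ => hne t) (hhas hgc hper hneg hS) fun t ht => ?_
  · refine (hS'.mul_left ‖(2 * π : ℂ)⁻¹‖).congr fun n => ?_
    rw [hnorm, norm_mul]
    ring
  · convert hhas hg' hper' hneg' hS' t ht using 2 with n
    have := hderiv n
    simp only [Int.cast_natCast] at this
    rw [this]
    ring

/-- `g` is multiplied by `e^{2πiρ}` over the period. -/
def HasMultiplier (ρ : ℝ) (g : ℝ → ℂ) : Prop :=
  ∀ k : ℤ, g (2 * π) * Complex.exp (-(((ρ + k : ℝ) : ℂ) * (2 * π) * Complex.I)) = g 0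

theorem HasMultiplier.combination {ρ : ℝ} {g h : ℝ → ℂ} (hg : HasMultiplier ρ g)
    (hh : HasMultiplier ρ h) (α β : ℂ) : HasMultiplier ρ fun t => α * g t + β * h t := by
  intro k
  have h₁ := hg k
  have h₂ := hh k
  linear_combination α * h₁ + β * h₂

namespace IsLinearizedSolution

variable {ν a s ρ : ℝ} {p q p₁ q₁ p₂ q₂ : ℝ → ℂ}

theorem recurrence_of_hasMultiplier (h : IsLinearizedSolution ν a s p q)
    (hp : HasMultiplier ρ p) (hq : HasMultiplier ρ q) (n : ℤ) (hn : ρ + n ≠ 0) :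
    (s / 2 : ℂ) * (fourierIntegralAt q (ρ + (n + 1 : ℤ)) - fourierIntegralAt q (ρ + (n - 1 : ℤ))) =
      Complex.I * ((ρ + n + a + ν ^ 2 / (4 * (ρ + n)) : ℝ) : ℂ) * fourierIntegralAt q (ρ + n) := by
  have := h.recurrence hn (hp n) (hq n)
  rwa [add_assoc ρ (n : ℝ) 1, add_sub_assoc, ← Int.cast_one, ← Int.cast_add, ← Int.cast_sub] at this

theorem exists_pow_mul_norm_fourierIntegralAt_le (h : IsLinearizedSolution ν a s p q)
    (ha : 0 < a) (hρ : 0 ≤ ρ) (hp : HasMultiplier ρ p) (hq : HasMultiplier ρ q) (j : ℕ) :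
    ∃ K, ∀ n : ℕ, ((n : ℝ) + 1) ^ j * ‖fourierIntegralAt q (ρ + n)‖ ≤ K := by
  obtain ⟨M, hM⟩ := norm_fourierIntegralAt_le h.continuous_snd
  refine exists_pow_mul_norm_le_of_recurrence
    (β := fun n : ℕ => ρ + (n + 1) + a + ν ^ 2 / (4 * (ρ + (n + 1)))) (fun n => hM _)
    (fun n => ?_) (fun n => ?_) (s := s) j
  · have : 0 ≤ ν ^ 2 / (4 * (ρ + (n + 1))) := by positivity
    linarith
  · have := h.recurrence_of_hasMultiplier hp hq (n + 1) (by push_cast; positivity)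
    push_cast at this ⊢
    rw [← this]
    ring_nf

theorem multiplier_not_generic (h₁ : IsLinearizedSolution ν a s p₁ q₁)
    (h₂ : IsLinearizedSolution ν a s p₂ q₂) (hν : ν ≠ 0) (hs : s ≠ 0) (ha : 0 < a) (hρ : 0 < ρ)
    (hdet : ∀ t, p₁ t * q₂ t - p₂ t * q₁ t ≠ 0)
    (hp₁ : HasMultiplier ρ p₁) (hq₁ : HasMultiplier ρ q₁)
    (hp₂ : HasMultiplier ρ p₂) (hq₂ : HasMultiplier ρ q₂) :
    ∃ k : ℤ, ρ + k = 0 := by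
  by_contra! hne
  have hs' : (s / 2 : ℂ) ≠ 0 := by simpa using hs
  set W : ℕ → ℂ := fun n => fourierIntegralAt q₁ (ρ + n) * fourierIntegralAt q₂ (ρ + (n + 1 : ℕ)) -
    fourierIntegralAt q₁ (ρ + (n + 1 : ℕ)) * fourierIntegralAt q₂ (ρ + n) with hW
  have htendsto : ∀ {p q : ℝ → ℂ}, IsLinearizedSolution ν a s p q → HasMultiplier ρ p →
      HasMultiplier ρ q → Tendsto (fun n : ℕ => fourierIntegralAt q (ρ + n)) atTop (𝓝 0) := by
    intro p q h hp hq
    obtain ⟨K, hK⟩ := h.exists_pow_mul_norm_fourierIntegralAt_le ha hρ.le hp hq 1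
    have hlim := (tendsto_one_div_add_atTop_nhds_zero_nat (𝕜 := ℝ)).const_mul K
    rw [mul_zero] at hlim
    refine squeeze_zero_norm (fun n => ?_) hlim
    have := hK n
    have hn : (0 : ℝ) < (n : ℝ) + 1 := by positivity
    rw [mul_one_div, le_div_iff₀ hn, mul_comm]
    simpa using this
  have hWlim : Tendsto W atTop (𝓝 0) := by
    have t₁ := htendsto h₁ hp₁ hq₁
    have t₂ := htendsto h₂ hp₂ hq₂
    simpa only [mul_zero, sub_zero] using (t₁.mul ((tendsto_add_atTop_iff_nat 1).2 t₂)).sub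
      (((tendsto_add_atTop_iff_nat 1).2 t₁).mul t₂)
  have hWsucc : ∀ n, ‖W (n + 1)‖ = ‖W n‖ := by
    intro n
    have e₁ := h₁.recurrence_of_hasMultiplier hp₁ hq₁ (n + 1) (hne _)
    have e₂ := h₂.recurrence_of_hasMultiplier hp₂ hq₂ (n + 1) (hne _)
    rw [← norm_neg (W n)]
    congr 1
    apply mul_left_cancel₀ hs'
    simp only [hW]
    simp only [add_sub_cancel_right] at e₁ e₂
    push_cast at e₁ e₂ ⊢
    linear_combination fourierIntegralAt q₁ (ρ + (n + 1)) * e₂ -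
      fourierIntegralAt q₂ (ρ + (n + 1)) * e₁
  have hWconst : ∀ n, ‖W n‖ = ‖W 0‖ := by
    intro n
    induction n with
    | zero => rfl
    | succ n ih => rw [hWsucc, ih]
  have hW0 : W 0 = 0 := by
    have := hWlim.norm
    simp only [hWconst, norm_zero] at this
    exact norm_eq_zero.1 (tendsto_nhds_unique tendsto_const_nhds this)
  obtain ⟨α, β, hαβ, hzero, hone⟩ : ∃ α β : ℂ, (α ≠ 0 ∨ β ≠ 0) ∧
      α * fourierIntegralAt q₁ ρ + β * fourierIntegralAt q₂ ρ = 0 ∧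
      α * fourierIntegralAt q₁ (ρ + 1) + β * fourierIntegralAt q₂ (ρ + 1) = 0 := by
    simp only [hW, Nat.cast_zero, add_zero, zero_add, Nat.cast_one] at hW0
    by_cases hA : fourierIntegralAt q₁ ρ = 0
    · by_cases hB : fourierIntegralAt q₁ (ρ + 1) = 0
      · exact ⟨1, 0, Or.inl one_ne_zero, by simp [hA], by simp [hB]⟩
      · exact ⟨-fourierIntegralAt q₂ (ρ + 1), fourierIntegralAt q₁ (ρ + 1), Or.inr hB,
          by linear_combination -hW0, by ring⟩
    · exact ⟨-fourierIntegralAt q₂ ρ, fourierIntegralAt q₁ ρ, Or.inr hA, by ring,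
        by linear_combination hW0⟩
  have h := h₁.combination h₂ α β
  have hp := hp₁.combination hp₂ α β
  have hq := hq₁.combination hq₂ α β
  have hcomb := fourierIntegralAt_combination h₁.continuous_snd h₂.continuous_snd α β
  rw [← hcomb] at hzero hone
  clear hcomb
  have hqv : ∀ t, (fun t => α * q₁ t + β * q₂ t) t = α * q₁ t + β * q₂ t := fun _ => rfl
  have hpv : ∀ t, (fun t => α * p₁ t + β * p₂ t) t = α * p₁ t + β * p₂ t := fun _ => rfl
  generalize (fun t => α * q₁ t + β * q₂ t) = q at *
  generalize (fun t => α * p₁ t + β * p₂ t) = p at *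
  have hall : ∀ n : ℤ, fourierIntegralAt q (ρ + n) = 0 ∧
      fourierIntegralAt q (ρ + (n + 1 : ℤ)) = 0 := by
    intro n
    induction n using Int.induction_on with
    | zero => simpa using ⟨hzero, hone⟩
    | succ n ih =>
      have e := h.recurrence_of_hasMultiplier hp hq (n + 1) (hne _)
      rw [add_sub_cancel_right, ih.1, ih.2, mul_zero, sub_zero] at e
      exact ⟨ih.2, (mul_eq_zero.1 e).resolve_left hs'⟩
    | pred n ih =>
      have e := h.recurrence_of_hasMultiplier hp hq (-n) (hne _)
      rw [ih.1, ih.2, mul_zero, zero_sub, mul_neg, neg_eq_zero] at e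
      refine ⟨(mul_eq_zero.1 e).resolve_left hs', ?_⟩
      rw [sub_add_cancel]
      exact ih.1
  have hqzero : ∀ t ∈ Icc 0 (2 * π), q t = 0 := by
    intro t ht
    have hqc := h.continuous_snd
    have hcoef : ∀ n : ℤ, (∫ t in (0 : ℝ)..2 * π, q t * Complex.exp (-(ρ * t * Complex.I)) *
        Complex.exp (-(n * t * Complex.I))) = 0 := by
      intro n
      rw [← (hall n).1, fourierIntegralAt]
      refine intervalIntegral.integral_congr fun t _ => ?_
      simp only [mul_assoc, ← Complex.exp_add]
      congr 2
      push_cast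
      ring
    have := hasSum_fourier_integral (g := fun t => q t * Complex.exp (-(ρ * t * Complex.I)))
      (by fun_prop) (by simpa using (hq 0).symm) (by simpa only [hcoef] using summable_zero) ht
    simp only [hcoef, mul_zero, zero_mul] at this
    have := hasSum_zero.unique this
    simpa [Complex.exp_ne_zero] using this.symm
  have hπ : Icc 0 (2 * π) ∈ 𝓝 π := Icc_mem_nhds Real.pi_pos (by linarith [Real.pi_pos])
  have hqπ : q π = 0 := hqzero π (mem_of_mem_nhds hπ)
  have hpπ : p π = 0 := by
    have hd : HasDerivAt q 0 π := (hasDerivAt_const π (0 : ℂ)).congr_of_eventuallyEq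
      (by filter_upwards [hπ] with t ht using hqzero t ht)
    have := (h.hasDerivAt_snd π).unique hd
    simpa [hqπ, hν] using this
  rw [hqv] at hqπ
  rw [hpv] at hpπ
  rcases hαβ with hα | hβ
  · exact hdet π ((mul_eq_zero.1 (by linear_combination q₂ π * hpπ - p₂ π * hqπ :
      α * (p₁ π * q₂ π - p₂ π * q₁ π) = 0)).resolve_left hα)
  · exact hdet π ((mul_eq_zero.1 (by linear_combination p₁ π * hqπ - q₁ π * hpπ :
      β * (p₁ π * q₂ π - p₂ π * q₁ π) = 0)).resolve_left hβ)

/-- If all solutions are periodic, a nontrivial one has only nonnegative frequencies. -/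
theorem exists_nonneg_spectrum (h₁ : IsLinearizedSolution ν a s p₁ q₁)
    (h₂ : IsLinearizedSolution ν a s p₂ q₂) (hs : s ≠ 0)
    (hdet : ∀ t, p₁ t * q₂ t - p₂ t * q₁ t ≠ 0)
    (hp₁ : HasMultiplier 0 p₁) (hq₁ : HasMultiplier 0 q₁)
    (hp₂ : HasMultiplier 0 p₂) (hq₂ : HasMultiplier 0 q₂) :
    ∃ p q, IsLinearizedSolution ν a s p q ∧ (∀ t, p t ≠ 0 ∨ q t ≠ 0) ∧
      HasMultiplier 0 p ∧ HasMultiplier 0 q ∧ ∀ n : ℤ, n ≤ 0 → fourierIntegralAt q n = 0 := by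
  have hs' : (s / 2 : ℂ) ≠ 0 := by simpa using hs
  obtain ⟨α, β, hαβ, hneg⟩ : ∃ α β : ℂ, (α ≠ 0 ∨ β ≠ 0) ∧
      α * fourierIntegralAt q₁ (-1) + β * fourierIntegralAt q₂ (-1) = 0 := by
    by_cases hA : fourierIntegralAt q₁ (-1) = 0
    · exact ⟨1, 0, Or.inl one_ne_zero, by simp [hA]⟩
    · exact ⟨-fourierIntegralAt q₂ (-1), fourierIntegralAt q₁ (-1), Or.inr hA, by ring⟩
  have h := h₁.combination h₂ α β
  have hp := hp₁.combination hp₂ α β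
  have hq := hq₁.combination hq₂ α β
  rw [← fourierIntegralAt_combination h₁.continuous_snd h₂.continuous_snd α β] at hneg
  refine ⟨_, _, h, fun t => ?_, hp, hq, ?_⟩
  · by_contra! hzero
    obtain ⟨hpt, hqt⟩ := hzero
    rcases hαβ with hα | hβ
    · exact hdet t ((mul_eq_zero.1 (by linear_combination q₂ t * hpt - p₂ t * hqt :
        α * (p₁ t * q₂ t - p₂ t * q₁ t) = 0)).resolve_left hα)
    · exact hdet t ((mul_eq_zero.1 (by linear_combination p₁ t * hqt - q₁ t * hpt :
        β * (p₁ t * q₂ t - p₂ t * q₁ t) = 0)).resolve_left hβ)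
  · generalize (fun t => α * q₁ t + β * q₂ t) = q at *
    have hzero : fourierIntegralAt q 0 = 0 := by
      have := fourierIntegralAt_deriv h.hasDerivAt_fst h.continuous_snd (by simpa using hp 0)
        (κ := 0)
      simpa using this
    have hall : ∀ n : ℕ, fourierIntegralAt q (0 + (-n : ℤ)) = 0 ∧
        fourierIntegralAt q (0 + (-n - 1 : ℤ)) = 0 := by
      intro n
      induction n with
      | zero => simpa using ⟨hzero, hneg⟩
      | succ n ih =>
        have e := h.recurrence_of_hasMultiplier hp hq (-n - 1) (by
          have : (0 : ℝ) ≤ n := n.cast_nonneg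
          push_cast
          linarith)
        rw [sub_add_cancel, ih.1, ih.2, mul_zero, zero_sub, mul_neg, neg_eq_zero] at e
        have hn : (-((n + 1 : ℕ) : ℤ)) = -n - 1 := by push_cast; ring
        rw [hn]
        exact ⟨ih.2, (mul_eq_zero.1 e).resolve_left hs'⟩
    intro n hn
    have := (hall (-n).toNat).1
    rwa [Int.toNat_of_nonneg (by linarith), neg_neg, zero_add] at this

end IsLinearizedSolution

/-- The modulus of the linear solution lifting the class-D solution `x`. -/
noncomputable def liftAmplitude (ν : ℝ) (x : ℝ → ℝ) (t : ℝ) : ℝ :=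
  Real.exp (-(ν / 2) * ∫ τ in (0 : ℝ)..t, Real.cos (x τ))

/-- The first component of the linear solution lifting the class-D solution `x`. -/
noncomputable def liftFst (ν a s : ℝ) (x : ℝ → ℝ) (t : ℝ) : ℂ :=
  liftAmplitude ν x t * Complex.exp (((x t - (a * t - s * Real.cos t)) / 2 : ℝ) * Complex.I)

/-- The second component of the linear solution lifting the class-D solution `x`. -/
noncomputable def liftSnd (ν a s : ℝ) (x : ℝ → ℝ) (t : ℝ) : ℂ :=
  -(ν / 2) * liftAmplitude ν x t *
    Complex.exp ((-(x t + (a * t - s * Real.cos t)) / 2 : ℝ) * Complex.I)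

namespace IsClassDSolution

variable {ν a s : ℝ} {r : ℤ} {x y : ℝ → ℝ}

theorem hasDerivAt_liftAmplitude (hx : IsClassDSolution ν a s x) (t : ℝ) :
    HasDerivAt (liftAmplitude ν x) (-(ν / 2) * Real.cos (x t) * liftAmplitude ν x t) t := by
  have hc : Continuous fun τ => Real.cos (x τ) := Real.continuous_cos.comp hx.continuous
  exact ((hc.integral_hasStrictDerivAt 0 t).hasDerivAt.const_mul (-(ν / 2))).exp.congr_deriv
    (by rw [liftAmplitude]; ring)

theorem isLinearizedSolution_lift (hx : IsClassDSolution ν a s x) :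
    IsLinearizedSolution ν a s (liftFst ν a s x) (liftSnd ν a s x) := by
  have hphase : ∀ t, HasDerivAt (fun t => a * t - s * Real.cos t) (a + s * Real.sin t) t :=
    fun t => (((hasDerivAt_id t).const_mul a).fun_sub
      ((Real.hasDerivAt_cos t).const_mul s)).congr_deriv (by simp)
  have hexp : ∀ t, Complex.exp (x t * Complex.I) = Real.cos (x t) + Real.sin (x t) * Complex.I := by
    intro t
    rw [Complex.exp_mul_I, Complex.ofReal_cos, Complex.ofReal_sin]
  have hexp' : ∀ t,
      Complex.exp (-(x t * Complex.I)) = Real.cos (x t) - Real.sin (x t) * Complex.I := by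
    intro t
    rw [← neg_mul, Complex.exp_mul_I, Complex.cos_neg, Complex.sin_neg, Complex.ofReal_cos,
      Complex.ofReal_sin]
    ring
  refine ⟨fun t => ?_, fun t => ?_⟩
  · refine ((hx.hasDerivAt_liftAmplitude t).ofReal_comp.fun_mul
      ((((hx t).fun_sub (hphase t)).div_const 2).ofReal_comp.mul_const
        Complex.I).cexp).congr_deriv ?_
    have : Complex.exp ((-(x t + (a * t - s * Real.cos t)) / 2 : ℝ) * Complex.I) =
        Complex.exp (((x t - (a * t - s * Real.cos t)) / 2 : ℝ) * Complex.I) *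
          Complex.exp (-(x t * Complex.I)) := by
      rw [← Complex.exp_add]
      congr 1
      push_cast
      ring
    rw [liftSnd, this, hexp']
    push_cast
    ring
  · refine (((hx.hasDerivAt_liftAmplitude t).ofReal_comp.const_mul (-(ν / 2) : ℂ)).fun_mul
      ((((hx t).fun_add (hphase t)).fun_neg.div_const 2).ofReal_comp.mul_const
        Complex.I).cexp).congr_deriv ?_
    have : Complex.exp (((x t - (a * t - s * Real.cos t)) / 2 : ℝ) * Complex.I) =
        Complex.exp ((-(x t + (a * t - s * Real.cos t)) / 2 : ℝ) * Complex.I) *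
          Complex.exp (x t * Complex.I) := by
      rw [← Complex.exp_add]
      congr 1
      push_cast
      ring
    rw [liftSnd, liftFst, this, hexp]
    push_cast
    ring

/-- The Wronskian identity for two class-D solutions. -/
theorem liftAmplitude_mul_sin_eq (hx : IsClassDSolution ν a s x) (hy : IsClassDSolution ν a s y)
    (t : ℝ) : liftAmplitude ν x t * liftAmplitude ν y t * Real.sin ((y t - x t) / 2) =
      Real.sin ((y 0 - x 0) / 2) := by
  have hderiv : ∀ t, HasDerivAt
      (fun t => liftAmplitude ν x t * liftAmplitude ν y t * Real.sin ((y t - x t) / 2)) 0 t := by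
    intro t
    refine (((hx.hasDerivAt_liftAmplitude t).fun_mul (hy.hasDerivAt_liftAmplitude t)).fun_mul
      (((hy t).fun_sub (hx t)).div_const 2).sin).congr_deriv ?_
    obtain ⟨u, hu⟩ : ∃ u, u = (x t + y t) / 2 := ⟨_, rfl⟩
    obtain ⟨v, hv⟩ : ∃ v, v = (y t - x t) / 2 := ⟨_, rfl⟩
    have hxt : x t = u - v := by linarith
    have hyt : y t = u + v := by linarith
    rw [← hv, hxt, hyt, Real.cos_add, Real.cos_sub, Real.sin_add, Real.sin_sub]
    ring
  have := is_const_of_deriv_eq_zero (fun t => (hderiv t).differentiableAt)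
    (fun t => (hderiv t).deriv) t 0
  simpa [liftAmplitude] using this

theorem liftAmplitude_two_pi (hx : IsClassDSolution ν a s x)
    (hconstr : ∀ x : ℝ → ℝ, IsClassDSolution ν a s x → x (2 * π) = x 0 + 2 * π * (r : ℝ)) :
    liftAmplitude ν x (2 * π) = 1 := by
  have hmul : ∀ {x y : ℝ → ℝ}, IsClassDSolution ν a s x → IsClassDSolution ν a s y →
      x 0 < y 0 → y 0 < x 0 + 3 → liftAmplitude ν x (2 * π) * liftAmplitude ν y (2 * π) = 1 := by
    intro x y hx hy h₁ h₂
    have h := hx.liftAmplitude_mul_sin_eq hy (2 * π)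
    rw [hconstr x hx, hconstr y hy, add_sub_add_right_eq_sub] at h
    have hsin : 0 < Real.sin ((y 0 - x 0) / 2) :=
      Real.sin_pos_of_pos_of_lt_pi (by linarith) (by linarith [Real.pi_gt_three])
    exact mul_right_cancel₀ hsin.ne' (by rw [h, one_mul])
  obtain ⟨y, hy₀, hy⟩ := exists_eq ν a s (x 0 + 1)
  obtain ⟨z, hz₀, hz⟩ := exists_eq ν a s (x 0 + 2)
  have hxy := hmul hx hy (by linarith) (by linarith)
  have hxz := hmul hx hz (by linarith) (by linarith)
  have hyz := hmul hy hz (by linarith) (by linarith)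
  have hpos : 0 < liftAmplitude ν x (2 * π) := Real.exp_pos _
  have hsq : liftAmplitude ν x (2 * π) ^ 2 = 1 := by
    linear_combination (liftAmplitude ν x (2 * π) * liftAmplitude ν z (2 * π)) * hxy -
      liftAmplitude ν x (2 * π) ^ 2 * hyz + hxz
  exact (pow_eq_one_iff_of_nonneg hpos.le two_ne_zero).1 hsq

theorem hasMultiplier_liftFst (hx : IsClassDSolution ν a s x)
    (hconstr : ∀ x : ℝ → ℝ, IsClassDSolution ν a s x → x (2 * π) = x 0 + 2 * π * (r : ℝ))
    {ρ : ℝ} {m : ℤ} (hρ : (r - a) / 2 = ρ + m) : HasMultiplier ρ (liftFst ν a s x) := by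
  intro k
  have ha : a = r - 2 * (ρ + m) := by linarith
  have h₀ : liftAmplitude ν x 0 = 1 := by simp [liftAmplitude]
  rw [liftFst, liftFst, hx.liftAmplitude_two_pi hconstr, hconstr x hx, h₀, mul_assoc,
    ← Complex.exp_add]
  congr 1
  refine Complex.exp_eq_exp_iff_exists_int.2 ⟨m - k, ?_⟩
  rw [ha]
  push_cast
  simp
  ring

theorem hasMultiplier_liftSnd (hx : IsClassDSolution ν a s x)
    (hconstr : ∀ x : ℝ → ℝ, IsClassDSolution ν a s x → x (2 * π) = x 0 + 2 * π * (r : ℝ))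
    {ρ : ℝ} {m : ℤ} (hρ : (r - a) / 2 = ρ + m) : HasMultiplier ρ (liftSnd ν a s x) := by
  intro k
  have ha : a = r - 2 * (ρ + m) := by linarith
  have h₀ : liftAmplitude ν x 0 = 1 := by simp [liftAmplitude]
  rw [liftSnd, liftSnd, hx.liftAmplitude_two_pi hconstr, hconstr x hx, h₀, mul_assoc,
    ← Complex.exp_add]
  congr 1
  refine Complex.exp_eq_exp_iff_exists_int.2 ⟨m - k - r, ?_⟩
  rw [ha]
  push_cast
  simp
  ring

theorem lift_det_ne_zero (hν : ν ≠ 0) (hx : IsClassDSolution ν a s x)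
    (hy : IsClassDSolution ν a s y) (hxy : x 0 < y 0) (hyx : y 0 < x 0 + 2 * π) (t : ℝ) :
    liftFst ν a s x t * liftSnd ν a s y t - liftFst ν a s y t * liftSnd ν a s x t ≠ 0 := by
  have hsin : Real.sin ((y 0 - x 0) / 2) ≠ 0 :=
    (Real.sin_pos_of_pos_of_lt_pi (by linarith) (by linarith)).ne'
  rw [← hx.liftAmplitude_mul_sin_eq hy t] at hsin
  have hexp : ∀ u v : ℝ, Complex.exp ((u - (a * t - s * Real.cos t)) / 2 * Complex.I) *
      Complex.exp (-(v + (a * t - s * Real.cos t)) / 2 * Complex.I) =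
      Complex.exp (-((a * t - s * Real.cos t) * Complex.I)) *
        Complex.exp ((u - v) / 2 * Complex.I) := by
    intro u v
    rw [← Complex.exp_add, ← Complex.exp_add]
    congr 1
    ring
  have hdiff : Complex.exp ((x t - y t) / 2 * Complex.I) - Complex.exp ((y t - x t) / 2 * Complex.I)
      = -2 * Complex.I * Real.sin ((y t - x t) / 2) := by
    have : ((x t - y t) / 2 : ℂ) = -((y t - x t) / 2) := by ring
    rw [this, Complex.exp_mul_I, Complex.exp_mul_I, Complex.cos_neg, Complex.sin_neg]
    push_cast
    ring
  have : liftFst ν a s x t * liftSnd ν a s y t - liftFst ν a s y t * liftSnd ν a s x t =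
      ν * Complex.I * Complex.exp (-((a * t - s * Real.cos t) * Complex.I)) *
        ((liftAmplitude ν x t * liftAmplitude ν y t * Real.sin ((y t - x t) / 2) : ℝ) : ℂ) := by
    have hx' := hexp (x t) (y t)
    have hy' := hexp (y t) (x t)
    simp only [liftFst, liftSnd]
    push_cast at hx' hy' hdiff ⊢
    linear_combination (-(ν / 2) * liftAmplitude ν x t * liftAmplitude ν y t : ℂ) *
      (hx' - hy' + Complex.exp (-((a * t - s * Complex.cos t) * Complex.I)) * hdiff)
  rw [this]
  simp only [ne_eq, mul_eq_zero, Complex.ofReal_eq_zero, Complex.I_ne_zero, Complex.exp_ne_zero, hν,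
    or_self, false_or]
  simpa using hsin

end IsClassDSolution

/-- For positive abscissa all solutions of the linear system are periodic and some nontrivial one
has only positive frequencies in its derivative. -/
theorem exists_isLinearizedSolution_nonneg_spectrum {ν a s : ℝ} {r : ℤ} (hν : ν ≠ 0) (hs : s ≠ 0)
    (ha : 0 < a)
    (hconstr : ∀ x : ℝ → ℝ, IsClassDSolution ν a s x → x (2 * π) = x 0 + 2 * π * (r : ℝ)) :
    ∃ p q, IsLinearizedSolution ν a s p q ∧ (∀ t, p t ≠ 0 ∨ q t ≠ 0) ∧
      HasMultiplier 0 p ∧ HasMultiplier 0 q ∧ ∀ n : ℤ, n ≤ 0 → fourierIntegralAt q n = 0 := by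
  obtain ⟨x, hx₀, hx⟩ := IsClassDSolution.exists_eq ν a s 0
  obtain ⟨y, hy₀, hy⟩ := IsClassDSolution.exists_eq ν a s π
  have hdet := hx.lift_det_ne_zero hν hy (by rw [hx₀, hy₀]; exact Real.pi_pos)
    (by rw [hx₀, hy₀]; linarith [Real.pi_pos])
  have hρ : ((r - a) / 2 : ℝ) = Int.fract ((r - a) / 2 : ℝ) + ⌊((r - a) / 2 : ℝ)⌋ :=
    (Int.fract_add_floor _).symm
  have hfract : Int.fract ((r - a) / 2 : ℝ) = 0 := by
    by_contra hne
    have hpos := lt_of_le_of_ne (Int.fract_nonneg ((r - a) / 2 : ℝ)) (Ne.symm hne)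
    obtain ⟨k, hk⟩ := hx.isLinearizedSolution_lift.multiplier_not_generic
      hy.isLinearizedSolution_lift hν hs ha hpos hdet (hx.hasMultiplier_liftFst hconstr hρ)
      (hx.hasMultiplier_liftSnd hconstr hρ) (hy.hasMultiplier_liftFst hconstr hρ)
      (hy.hasMultiplier_liftSnd hconstr hρ)
    have hlt := Int.fract_lt_one ((r - a) / 2 : ℝ)
    have h₁ : (-1 : ℝ) < k := by linarith
    have h₂ : (k : ℝ) < 0 := by linarith
    norm_cast at h₁ h₂
    omega
  rw [hfract] at hρ
  exact hx.isLinearizedSolution_lift.exists_nonneg_spectrum hy.isLinearizedSolution_lift hs hdet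
    (hx.hasMultiplier_liftFst hconstr hρ) (hx.hasMultiplier_liftSnd hconstr hρ)
    (hy.hasMultiplier_liftFst hconstr hρ) (hy.hasMultiplier_liftSnd hconstr hρ)

theorem im_intervalIntegral_of_continuous {g : ℝ → ℂ} (hg : Continuous g) (b c : ℝ) :
    (∫ t in b..c, g t).im = ∫ t in b..c, (g t).im :=
  (Complex.imCLM.intervalIntegral_comp_comm (hg.intervalIntegrable b c)).symm

theorem IsClassDSolution.mul_integral_sin {ν a s : ℝ} {r : ℤ} {x : ℝ → ℝ}
    (hx : IsClassDSolution ν a s x) (hper : x (2 * π) = x 0 + 2 * π * (r : ℝ)) :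
    ν * ∫ t in (0 : ℝ)..2 * π, Real.sin (x t) = 2 * π * (r - a) := by
  have hxc := hx.continuous
  have h := intervalIntegral.integral_eq_sub_of_hasDerivAt (a := 0) (b := 2 * π)
    (fun t _ => hx t) (Continuous.intervalIntegrable (by fun_prop) _ _)
  rw [intervalIntegral.integral_add (Continuous.intervalIntegrable (by fun_prop) _ _)
    (Continuous.intervalIntegrable (by fun_prop) _ _), intervalIntegral.integral_add
    (Continuous.intervalIntegrable (by fun_prop) _ _)
    (Continuous.intervalIntegrable (by fun_prop) _ _), intervalIntegral.integral_const_mul,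
    intervalIntegral.integral_const_mul, integral_sin, intervalIntegral.integral_const, hper] at h
  simp at h
  linear_combination h

/-- A periodic solution in the closed unit disc of the complexified class-D equation has the same
rotation number as the real solutions. -/
theorem half_mul_integral_im_eq_of_riccati {ν a s : ℝ} {r : ℤ}
    (hconstr : ∀ x : ℝ → ℝ, IsClassDSolution ν a s x → x (2 * π) = x 0 + 2 * π * (r : ℝ))
    {w : ℝ → ℂ} (hw : ∀ t, HasDerivAt w
      (-(ν / 2) * (1 - w t ^ 2) - Complex.I * (a + s * Real.sin t) * w t) t)
    (hnorm : ∀ t, ‖w t‖ ≤ 1) (hper : w 0 = w (2 * π)) :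
    ν / 2 * ∫ t in (0 : ℝ)..2 * π, (w t).im = -(π * (r - a)) := by
  have hwc : Continuous w := continuous_iff_continuousAt.2 fun t => (hw t).continuousAt
  obtain ⟨x, hx, hx₀⟩ : ∃ x, IsClassDSolution ν a s x ∧
      1 - w 0 * Complex.exp (x 0 * Complex.I) ≠ 0 := by
    by_cases h : w 0 = 1
    · obtain ⟨x, hx₀, hx⟩ := IsClassDSolution.exists_eq ν a s π
      refine ⟨x, hx, ?_⟩
      rw [h, hx₀, Complex.exp_pi_mul_I]
      norm_num
    · obtain ⟨x, hx₀, hx⟩ := IsClassDSolution.exists_eq ν a s 0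
      refine ⟨x, hx, ?_⟩
      rw [hx₀]
      simpa [sub_eq_zero] using Ne.symm h
  have hxc := hx.continuous
  set φ : ℝ → ℂ := fun t => ν / 2 * (w t + Complex.exp (x t * Complex.I)) with hφ
  have hφc : Continuous φ := by fun_prop
  have hderiv : ∀ t, HasDerivAt (fun t => 1 - w t * Complex.exp (x t * Complex.I))
      (φ t * (1 - w t * Complex.exp (x t * Complex.I))) t := by
    intro t
    refine (((hw t).fun_mul ((hx t).ofReal_comp.mul_const Complex.I).cexp).const_sub
      1).congr_deriv ?_
    have hsin : Complex.exp (x t * Complex.I) * (2 * Complex.I * Real.sin (x t)) =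
        Complex.exp (x t * Complex.I) ^ 2 - 1 := by
      rw [Complex.exp_mul_I, Complex.ofReal_sin]
      linear_combination Complex.sin (x t) ^ 2 * Complex.I_sq -
        Complex.sin_sq_add_cos_sq (x t : ℂ)
    simp only [hφ]
    push_cast at hsin ⊢
    linear_combination (-(ν / 2) * w t : ℂ) * hsin
  have hne : ∀ t, 1 - w t * Complex.exp (x t * Complex.I) ≠ 0 := by
    intro t ht
    have hconst : ∀ t, HasDerivAt (fun t => (1 - w t * Complex.exp (x t * Complex.I)) *
        Complex.exp (-∫ τ in (0 : ℝ)..t, φ τ)) 0 t := fun t =>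
      ((hderiv t).fun_mul (hφc.integral_hasStrictDerivAt 0 t).hasDerivAt.fun_neg.cexp).congr_deriv
        (by ring)
    have := is_const_of_deriv_eq_zero (fun t => (hconst t).differentiableAt)
      (fun t => (hconst t).deriv) t 0
    simp only [ht, zero_mul, intervalIntegral.integral_same, neg_zero, Complex.exp_zero,
      mul_one] at this
    exact hx₀ this.symm
  have hslit : ∀ t, 1 - w t * Complex.exp (x t * Complex.I) ∈ Complex.slitPlane := by
    intro t
    have hle : ‖w t * Complex.exp (x t * Complex.I)‖ ≤ 1 := by
      rw [norm_mul, Complex.norm_exp_ofReal_mul_I, mul_one]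
      exact hnorm t
    have ht := hne t
    generalize w t * Complex.exp (x t * Complex.I) = z at hle ht
    refine Complex.mem_slitPlane_iff.2 ?_
    by_contra! hz
    obtain ⟨hre, him⟩ := hz
    simp only [Complex.sub_re, Complex.one_re, Complex.sub_im, Complex.one_im] at hre him
    have hone := (Complex.re_le_norm z).trans hle
    exact ht (Complex.ext (by simp; linarith) (by simpa using him))
  have hcoef := intervalIntegral.integral_eq_sub_of_hasDerivAt (a := 0) (b := 2 * π) (f' := φ)
    (fun t _ => ((hderiv t).clog_real (hslit t)).congr_deriv (by rw [mul_div_cancel_right₀ _ (hne t)]))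
    (hφc.intervalIntegrable _ _)
  have hexp : Complex.exp (x (2 * π) * Complex.I) = Complex.exp (x 0 * Complex.I) := by
    rw [hconstr x hx]
    exact Complex.exp_eq_exp_iff_exists_int.2 ⟨r, by push_cast; ring⟩
  rw [hexp, hper, sub_self] at hcoef
  have him : ∀ t, (φ t).im = ν / 2 * (w t).im + ν / 2 * Real.sin (x t) := by
    intro t
    have h2 : (ν / 2 : ℂ) = ((ν / 2 : ℝ) : ℂ) := by push_cast; rfl
    simp only [hφ]
    rw [h2, Complex.im_ofReal_mul, Complex.add_im, Complex.exp_ofReal_mul_I_im]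
    ring
  have hsum := congrArg Complex.im hcoef
  rw [im_intervalIntegral_of_continuous hφc] at hsum
  simp only [him] at hsum
  rw [intervalIntegral.integral_add (Continuous.intervalIntegrable (by fun_prop) _ _)
    (Continuous.intervalIntegrable (by fun_prop) _ _), intervalIntegral.integral_const_mul,
    intervalIntegral.integral_const_mul, Complex.zero_im] at hsum
  linear_combination hsum - hx.mul_integral_sin (hconstr x hx) / 2

theorem HasMultiplier.eq_of_zero {g : ℝ → ℂ} (hg : HasMultiplier 0 g) : g 0 = g (2 * π) := by
  simpa using (hg 0).symm

namespace IsLinearizedSolution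

variable {ν a s : ℝ} {r : ℤ} {p q : ℝ → ℂ}

/-- The linear system preserves the indefinite form `|p|² - (4 / ν²) |q|²`. -/
theorem normSq_sub_normSq_eq (h : IsLinearizedSolution ν a s p q) (t : ℝ) :
    ν ^ 2 / 4 * Complex.normSq (p t) - Complex.normSq (q t) =
      ν ^ 2 / 4 * Complex.normSq (p 0) - Complex.normSq (q 0) := by
  have hderiv : ∀ t, HasDerivAt
      (fun t => (ν : ℂ) ^ 2 / 4 * (p t * star (p t)) - q t * star (q t)) 0 t := by
    intro t
    refine ((((h.hasDerivAt_fst t).fun_mul (h.hasDerivAt_fst t).star).const_mul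
      ((ν : ℂ) ^ 2 / 4)).fun_sub
        ((h.hasDerivAt_snd t).fun_mul (h.hasDerivAt_snd t).star)).congr_deriv ?_
    simp [← Complex.sin_conj]
    ring
  have := is_const_of_deriv_eq_zero (fun t => (hderiv t).differentiableAt)
    (fun t => (hderiv t).deriv) t 0
  simp only [Complex.star_def, Complex.mul_conj] at this
  exact_mod_cast this

theorem winding_nonneg_fst (h : IsLinearizedSolution ν a s p q) (ha : 0 < a)
    (hp : HasMultiplier 0 p) (hq : HasMultiplier 0 q)
    (hspec : ∀ n : ℤ, n ≤ 0 → fourierIntegralAt q n = 0) (hne : ∀ t, p t ≠ 0) :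
    0 ≤ (∫ t in (0 : ℝ)..2 * π, q t / p t).im := by
  refine im_integral_logDeriv_nonneg_of_fourierIntegralAt h.hasDerivAt_fst h.continuous_snd
    hp.eq_of_zero hq.eq_of_zero hne (fun n hn => ?_) ?_
  · have := fourierIntegralAt_deriv h.hasDerivAt_fst h.continuous_snd (κ := n)
      (by simpa using hp n)
    rw [hspec n hn.le] at this
    have hn' : (n : ℂ) ≠ 0 := by exact_mod_cast hn.ne
    simpa [hn'] using this.symm
  · simpa using h.exists_pow_mul_norm_fourierIntegralAt_le ha le_rfl hp hq 2

theorem winding_nonneg_snd (h : IsLinearizedSolution ν a s p q) (ha : 0 < a)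
    (hp : HasMultiplier 0 p) (hq : HasMultiplier 0 q)
    (hspec : ∀ n : ℤ, n ≤ 0 → fourierIntegralAt q n = 0) (hne : ∀ t, q t ≠ 0) :
    0 ≤ (∫ t in (0 : ℝ)..2 * π,
      ((ν : ℂ) ^ 2 / 4 * p t - Complex.I * (a + s * Real.sin t) * q t) / q t).im := by
  have hpc := h.continuous_fst
  have hqc := h.continuous_snd
  have hc : Continuous fun t : ℝ =>
    (ν : ℂ) ^ 2 / 4 * p t - Complex.I * (a + s * Real.sin t) * q t := by fun_prop
  refine im_integral_logDeriv_nonneg_of_fourierIntegralAt h.hasDerivAt_snd hc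
    hq.eq_of_zero ?_ hne (fun n hn => hspec n hn.le) ?_
  · simp [hp.eq_of_zero, hq.eq_of_zero]
  · obtain ⟨K, hK⟩ := h.exists_pow_mul_norm_fourierIntegralAt_le ha le_rfl hp hq 3
    refine ⟨K, fun n => le_trans ?_ (hK n)⟩
    rw [fourierIntegralAt_deriv h.hasDerivAt_snd hc (κ := n) (by simpa using hq n), zero_add]
    simp only [norm_mul, Complex.norm_I, one_mul, Complex.norm_real, Real.norm_natCast]
    rw [pow_succ _ 2, mul_assoc]
    gcongr
    linarith

theorem integral_im_of_norm_snd_le (h : IsLinearizedSolution ν a s p q) (hν : ν ≠ 0)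
    (hconstr : ∀ x : ℝ → ℝ, IsClassDSolution ν a s x → x (2 * π) = x 0 + 2 * π * (r : ℝ))
    (hp : HasMultiplier 0 p) (hq : HasMultiplier 0 q) (hne : ∀ t, p t ≠ 0)
    (hle : ∀ t, Complex.normSq (q t) ≤ ν ^ 2 / 4 * Complex.normSq (p t)) :
    (∫ t in (0 : ℝ)..2 * π, q t / p t).im = π * (r - a) := by
  have hpc := h.continuous_fst
  have hqc := h.continuous_snd
  have hν' : (ν : ℂ) ≠ 0 := by exact_mod_cast hν
  have key := half_mul_integral_im_eq_of_riccati hconstr (w := fun t => -(2 / ν) * (q t / p t))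
    (fun t => ?_) (fun t => ?_) (by simp [hp.eq_of_zero, hq.eq_of_zero])
  · have hqp : Continuous fun t => q t / p t := hqc.div hpc hne
    rw [im_intervalIntegral_of_continuous hqp, ← neg_eq_iff_eq_neg.2 key,
      ← intervalIntegral.integral_const_mul, ← intervalIntegral.integral_neg]
    refine intervalIntegral.integral_congr fun t _ => ?_
    have : (-(2 / ν) * (q t / p t) : ℂ) = ((-(2 / ν) : ℝ) : ℂ) * (q t / p t) := by push_cast; rfl
    simp only [this, Complex.im_ofReal_mul]
    field_simp
  · refine (((h.hasDerivAt_snd t).fun_div (h.hasDerivAt_fst t) (hne t)).const_mul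
      (-(2 / ν) : ℂ)).congr_deriv ?_
    have := hne t
    field_simp
    ring
  · rw [← sq_le_one_iff₀ (norm_nonneg _), ← Complex.normSq_eq_norm_sq]
    have : (-(2 / ν) * (q t / p t) : ℂ) = ((-(2 / ν) : ℝ) : ℂ) * (q t / p t) := by push_cast; rfl
    rw [this, map_mul, map_div₀, Complex.normSq_ofReal]
    have hpos := Complex.normSq_pos.2 (hne t)
    rw [mul_div_assoc', div_le_one hpos]
    have := hle t
    have hν2 : 0 < ν ^ 2 := by positivity
    field_simp
    rw [div_le_iff₀ hν2]
    linarith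

theorem integral_im_of_norm_fst_le (h : IsLinearizedSolution ν a s p q)
    (hconstr : ∀ x : ℝ → ℝ, IsClassDSolution ν a s x → x (2 * π) = x 0 + 2 * π * (r : ℝ))
    (hp : HasMultiplier 0 p) (hq : HasMultiplier 0 q) (hne : ∀ t, q t ≠ 0)
    (hle : ∀ t, ν ^ 2 / 4 * Complex.normSq (p t) ≤ Complex.normSq (q t)) :
    (∫ t in (0 : ℝ)..2 * π,
      ((ν : ℂ) ^ 2 / 4 * p t - Complex.I * (a + s * Real.sin t) * q t) / q t).im =
        -(π * (r + a)) := by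
  have hpc := h.continuous_fst
  have hqc := h.continuous_snd
  have hcast : ∀ t, (-(ν / 2) * (p t / q t) : ℂ) = ((-(ν / 2) : ℝ) : ℂ) * (p t / q t) := by
    intro t
    push_cast
    rfl
  have key := half_mul_integral_im_eq_of_riccati hconstr
    (w := fun t => star (-(ν / 2) * (p t / q t) : ℂ))
    (fun t => ?_) (fun t => ?_) (by simp [hp.eq_of_zero, hq.eq_of_zero])
  · have hpq : Continuous fun t => p t / q t := hpc.div hqc hne
    have him : ∀ t, (((ν : ℂ) ^ 2 / 4 * p t - Complex.I * (a + s * Real.sin t) * q t) / q t).im =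
        ν / 2 * (star (-(ν / 2) * (p t / q t) : ℂ)).im - (a + s * Real.sin t) := by
      intro t
      have : ((ν : ℂ) ^ 2 / 4 * p t - Complex.I * (a + s * Real.sin t) * q t) / q t =
          ((ν ^ 2 / 4 : ℝ) : ℂ) * (p t / q t) - ((a + s * Real.sin t : ℝ) : ℂ) * Complex.I := by
        have := hne t
        push_cast
        field_simp
      rw [this, hcast, Complex.star_def, Complex.conj_im, Complex.im_ofReal_mul, Complex.sub_im,
        Complex.im_ofReal_mul, Complex.im_ofReal_mul, Complex.I_im]
      ring
    have hsin : ∫ t in (0 : ℝ)..2 * π, (a + s * Real.sin t) = 2 * π * a := by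
      rw [intervalIntegral.integral_add (Continuous.intervalIntegrable (by fun_prop) _ _)
        (Continuous.intervalIntegrable (by fun_prop) _ _), intervalIntegral.integral_const_mul,
        integral_sin]
      simp
    have hc : Continuous fun t : ℝ =>
        ((ν : ℂ) ^ 2 / 4 * p t - Complex.I * (a + s * Real.sin t) * q t) / q t :=
      Continuous.div (by fun_prop) hqc hne
    rw [im_intervalIntegral_of_continuous hc]
    simp only [him]
    rw [intervalIntegral.integral_sub (Continuous.intervalIntegrable (by fun_prop) _ _)
      (Continuous.intervalIntegrable (by fun_prop) _ _), intervalIntegral.integral_const_mul, key,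
      hsin]
    ring
  · refine (((h.hasDerivAt_fst t).fun_div (h.hasDerivAt_snd t) (hne t)).const_mul
      (-(ν / 2) : ℂ)).star.congr_deriv ?_
    rw [← star_star (-(ν / 2) * (1 - _) - _ : ℂ)]
    congr 1
    have := hne t
    simp [← Complex.sin_conj]
    field_simp
    ring
  · rw [← sq_le_one_iff₀ (norm_nonneg _), norm_star, ← Complex.normSq_eq_norm_sq, hcast, map_mul,
      map_div₀, Complex.normSq_ofReal]
    have hpos := Complex.normSq_pos.2 (hne t)
    rw [mul_div_assoc', div_le_one hpos]
    have := hle t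
    linarith

end IsLinearizedSolution

theorem abscissa_le_rotation {ν a s : ℝ} {r : ℤ} (hν : ν ≠ 0) (hs : s ≠ 0) (ha : 0 < a)
    (hconstr : ∀ x : ℝ → ℝ, IsClassDSolution ν a s x → x (2 * π) = x 0 + 2 * π * (r : ℝ)) :
    a ≤ r := by
  obtain ⟨p, q, h, hne, hp, hq, hspec⟩ :=
    exists_isLinearizedSolution_nonneg_spectrum hν hs ha hconstr
  have hν2 : 0 < ν ^ 2 / 4 := by positivity
  rcases le_total (Complex.normSq (q 0)) (ν ^ 2 / 4 * Complex.normSq (p 0)) with h₀ | h₀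
  · have hle : ∀ t, Complex.normSq (q t) ≤ ν ^ 2 / 4 * Complex.normSq (p t) := fun t => by
      linarith [h.normSq_sub_normSq_eq t]
    have hpne : ∀ t, p t ≠ 0 := by
      intro t hpt
      have hqt := hle t
      rw [hpt, map_zero, mul_zero] at hqt
      exact (hne t).elim (· hpt)
        (· (Complex.normSq_eq_zero.1 (hqt.antisymm (Complex.normSq_nonneg _))))
    have hwind := h.winding_nonneg_fst ha hp hq hspec hpne
    rw [h.integral_im_of_norm_snd_le hν hconstr hp hq hpne hle] at hwind
    linarith [nonneg_of_mul_nonneg_right hwind Real.pi_pos]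
  · have hle : ∀ t, ν ^ 2 / 4 * Complex.normSq (p t) ≤ Complex.normSq (q t) := fun t => by
      linarith [h.normSq_sub_normSq_eq t]
    have hqne : ∀ t, q t ≠ 0 := by
      intro t hqt
      have hpt := hle t
      rw [hqt, map_zero] at hpt
      have := Complex.normSq_nonneg (p t)
      exact (hne t).elim (· (Complex.normSq_eq_zero.1 (by nlinarith))) (· hqt)
    have hwind := h.winding_nonneg_snd ha hp hq hspec hqne
    rw [h.integral_im_of_norm_fst_le hconstr hp hq hqne hle] at hwind
    have hr : (0 : ℝ) < r := by exact_mod_cast rotation_pos_of_abscissa_pos ha hconstr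
    have : 0 < π * (r + a) := by positivity
    linarith

/-- If `ν ≠ 0`, `s ≠ 0` and `(a, s)` is a constriction with rotation number `r`,
then `a = 0 ↔ r = 0`; if `r > 0` then `0 < a ≤ r`; and if `r < 0` then `r ≤ a < 0`. -/
theorem constriction_abscissa_sign_and_bound
    (ν a s : ℝ) (r : ℤ) (hν : ν ≠ 0) (hs : s ≠ 0)
    (hconstr : ∀ x : ℝ → ℝ, IsClassDSolution ν a s x →
      x (2 * π) = x 0 + 2 * π * (r : ℝ)) :
    (a = 0 ↔ r = 0) ∧ (0 < r → 0 < a ∧ a ≤ (r : ℝ)) ∧ (r < 0 → (r : ℝ) ≤ a ∧ a < 0) := by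
  rcases lt_trichotomy a 0 with ha | rfl | ha
  · have hconstr' : ∀ x : ℝ → ℝ, IsClassDSolution ν (-a) (-s) x →
        x (2 * π) = x 0 + 2 * π * ((-r : ℤ) : ℝ) := by
      intro x hx
      have := hconstr _ (by simpa using hx.neg)
      push_cast
      linarith
    have hr : r < 0 := neg_pos.1 (rotation_pos_of_abscissa_pos (neg_pos.2 ha) hconstr')
    have hle := abscissa_le_rotation hν (neg_ne_zero.2 hs) (neg_pos.2 ha) hconstr'
    push_cast at hle
    exact ⟨iff_of_false ha.ne hr.ne, fun h => absurd h hr.not_gt, fun _ => ⟨by linarith, ha⟩⟩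
  · have hr := rotation_eq_zero_of_abscissa_eq_zero hconstr
    exact ⟨iff_of_true rfl hr, fun h => absurd hr h.ne', fun h => absurd hr h.ne⟩
  · have hr := rotation_pos_of_abscissa_pos ha hconstr
    exact ⟨iff_of_false ha.ne' hr.ne', fun _ => ⟨ha, abscissa_le_rotation hν hs ha hconstr⟩,
      fun h => absurd h hr.not_gt⟩
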